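/- arXiv:1106.2854 — 4 statements merged into one kernel-verified Lean document; each statement's English description precedes it below -/
import Mathlib

section
/- For each ε > 0 and each positive integer k, there is an N such that whenever n > N and A ⊆ {1, …, n} satisfies |A|/n ≥ ε, there exist integers a and d ≥ 1 such that a + j·d ∈ A for every j with 0 ≤ j ≤ k−1 (i.e., A contains an arithmetic progression of length k). -/
namespace DensityHalesJewett

open Finset Combinatorics

/-! ### Counting -/

open scoped Classical in
/-- The number of points satisfying a predicate, as a real number. -/
noncomputable def count {X : Type*} [Fintype X] (p : X → Prop) : ℝ :=
  ∑ x, if p x then 1 else 0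

section Count

variable {X Y T : Type*} [Fintype X] [Fintype Y] [Fintype T]

lemma count_nonneg (p : X → Prop) : 0 ≤ count p :=
  sum_nonneg fun x _ ↦ by split_ifs <;> simp

lemma count_eq_card (p : X → Prop) [DecidablePred p] : count p = #{x | p x} := by
  unfold count
  rw [Finset.card_filter]
  push_cast
  congr!

lemma sum_count (p : Y → X → Prop) :
    ∑ y, count (p y) = count fun q : Y × X ↦ p q.1 q.2 := by
  unfold count
  rw [← Fintype.sum_prod_type']

lemma card_mul_count (p : X → Prop) :
    Fintype.card Y * count p = count fun q : X × Y ↦ p q.1 := by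
  rw [← sum_count (fun x (_ : Y) ↦ p x), count, mul_sum]
  refine sum_congr rfl fun x _ ↦ ?_
  by_cases h : p x <;> simp [count, h]

lemma ite_eq_add_of_imp {p q : Prop} [Decidable p] [Decidable q] [Decidable (p ∧ ¬ q)]
    (h : q → p) (r : ℝ) :
    (if p then r else 0) = (if q then r else 0) + if p ∧ ¬ q then r else 0 := by
  by_cases hp : p <;> by_cases hq : q <;> simp_all

lemma count_mono {p q : X → Prop} (h : ∀ x, p x → q x) : count p ≤ count q := by
  refine sum_le_sum fun x _ ↦ ?_
  have := h x
  split_ifs <;> simp_all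

lemma count_le_card (p : X → Prop) : count p ≤ Fintype.card X := by
  refine (count_mono (q := fun _ ↦ True) fun _ _ ↦ trivial).trans ?_
  simp [count]

lemma count_exists_le (p : T → X → Prop) : count (fun x ↦ ∃ t, p t x) ≤ ∑ t, count (p t) := by
  unfold count
  rw [sum_comm]
  refine sum_le_sum fun x _ ↦ ?_
  split_ifs with h
  · obtain ⟨t, ht⟩ := h
    refine le_trans ?_ (single_le_sum (fun t _ ↦ ?_) (mem_univ t))
    · simp [ht]
    · split_ifs <;> simp
  · exact sum_nonneg fun t _ ↦ by split_ifs <;> simp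

lemma exists_of_count_pos {p : X → Prop} (h : 0 < count p) : ∃ x, p x := by
  by_contra! hp
  simp [count, hp] at h

lemma sum_arrow_sum {α ι κ : Type*} [Fintype α] [Fintype ι] [Fintype κ] [DecidableEq ι]
    [DecidableEq κ] (f : (ι ⊕ κ → α) → ℝ) :
    ∑ w, f w = ∑ x : ι → α, ∑ y : κ → α, f (Sum.elim x y) := by
  rw [← Fintype.sum_prod_type']
  exact Fintype.sum_equiv (Equiv.sumArrowEquivProdArrow ι κ α) _ _ fun w ↦ by
    simp [Equiv.sumArrowEquivProdArrow]

lemma sum_arrow_sum' {α ι κ : Type*} [Fintype α] [Fintype ι] [Fintype κ] [DecidableEq ι]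
    [DecidableEq κ] (f : (ι ⊕ κ → α) → ℝ) :
    ∑ w, f w = ∑ y : κ → α, ∑ x : ι → α, f (Sum.elim x y) := by
  rw [sum_arrow_sum, sum_comm]

lemma count_arrow_sum {α ι κ : Type*} [Fintype α] [Fintype ι] [Fintype κ] [DecidableEq ι]
    [DecidableEq κ] (p : (ι ⊕ κ → α) → Prop) :
    count p = ∑ x : ι → α, count fun y : κ → α ↦ p (Sum.elim x y) :=
  sum_arrow_sum _

lemma count_arrow_sum' {α ι κ : Type*} [Fintype α] [Fintype ι] [Fintype κ] [DecidableEq ι]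
    [DecidableEq κ] (p : (ι ⊕ κ → α) → Prop) :
    count p = ∑ y : κ → α, count fun x : ι → α ↦ p (Sum.elim x y) :=
  sum_arrow_sum' _

lemma card_arrow_sum {α ι κ : Type*} [Fintype α] [Fintype ι] [Fintype κ] [DecidableEq ι]
    [DecidableEq κ] : (Fintype.card (ι ⊕ κ → α) : ℝ) =
      Fintype.card (ι → α) * Fintype.card (κ → α) := by
  simp [pow_add]

/-- If every dense member of a family of subsets of `X` contains one of finitely many sets `R t`
and the family is dense on average, then some `R t` is contained in a positive proportion of the
members. -/
lemma exists_dense_fibers [Nonempty X] [Nonempty Y] {δ : ℝ} (hδ : 0 < δ) (R : T → X → Prop)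
    (D : X → Y → Prop)
    (hR : ∀ y, (δ / 2 * Fintype.card X ≤ count fun x ↦ D x y) → ∃ t, ∀ x, R t x → D x y)
    (hD : δ * Fintype.card X * Fintype.card Y ≤ ∑ y, count fun x ↦ D x y) :
    ∃ t, δ / (2 * (Fintype.card T + 1)) * Fintype.card Y ≤
      count fun y ↦ ∀ x, R t x → D x y := by
  classical
  by_contra! hlt
  have hX : (0 : ℝ) < Fintype.card X := by exact_mod_cast Fintype.card_pos
  have hY : (0 : ℝ) < Fintype.card Y := by exact_mod_cast Fintype.card_pos
  have h1 : ∑ y, count (fun x ↦ D x y) ≤ δ / 2 * Fintype.card X * Fintype.card Y +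
      Fintype.card X * count fun y ↦ ∃ t, ∀ x, R t x → D x y := by
    have : δ / 2 * Fintype.card X * Fintype.card Y = ∑ _y : Y, δ / 2 * Fintype.card X := by
      simp [mul_comm]
    rw [this, count, mul_sum, ← sum_add_distrib]
    refine sum_le_sum fun y _ ↦ ?_
    split_ifs with hy
    · have := count_le_card fun x ↦ D x y
      have : 0 ≤ δ / 2 * Fintype.card X := by positivity
      linarith
    · rw [mul_zero, add_zero]
      by_contra! hc
      exact hy (hR y hc.le)
  have h2 := count_exists_le fun t y ↦ ∀ x, R t x → D x y
  have h3 : ∑ t, count (fun y ↦ ∀ x, R t x → D x y) ≤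
      ∑ _t : T, δ / (2 * (Fintype.card T + 1)) * Fintype.card Y :=
    sum_le_sum fun t _ ↦ (hlt t).le
  rw [sum_const, card_univ, nsmul_eq_mul] at h3
  have h4 : Fintype.card T * (δ / (2 * (Fintype.card T + 1)) * Fintype.card Y) <
      δ / 2 * Fintype.card Y := by
    rw [← mul_assoc]
    refine mul_lt_mul_of_pos_right ?_ hY
    rw [mul_div_assoc', div_lt_iff₀ (by positivity)]
    nlinarith
  have h5 := mul_lt_mul_of_pos_left (h2.trans_lt (h3.trans_lt h4)) hX
  nlinarith

end Count

/-! ### Lines and subspaces -/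

section Subspace

variable {α ι κ η : Type*}

instance [Finite α] [Finite ι] : Finite (Line α ι) :=
  Finite.of_injective Line.idxFun fun l m h ↦ by
    cases l; cases m; simp_all

instance [Finite α] [Finite ι] [Finite η] : Finite (Subspace η α ι) :=
  Finite.of_injective Subspace.idxFun fun l m h ↦ by
    cases l; cases m; simp_all

noncomputable instance [Finite α] [Finite ι] : Fintype (Line α ι) := Fintype.ofFinite _

noncomputable instance [Finite α] [Finite ι] [Finite η] : Fintype (Subspace η α ι) :=
  Fintype.ofFinite _

lemma subspace_injective (V : Subspace η α ι) : Function.Injective V := by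
  intro x y h
  ext e
  obtain ⟨i, hi⟩ := V.proper e
  simpa [Subspace.apply_inr hi] using congrFun h i

/-- The image of a subspace under the parametrization of another subspace. -/
def subspaceComp (V : Subspace κ α ι) (U : Subspace η α κ) : Subspace η α ι where
  idxFun i := (V.idxFun i).elim Sum.inl U.idxFun
  proper e := by
    obtain ⟨k, hk⟩ := U.proper e
    obtain ⟨i, hi⟩ := V.proper k
    exact ⟨i, by simp [hi, hk]⟩

lemma subspaceComp_apply (V : Subspace κ α ι) (U : Subspace η α κ) (x : η → α) :
    subspaceComp V U x = V (U x) := by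
  ext i
  cases h : V.idxFun i <;> simp [Subspace.apply_def, subspaceComp, h]

/-- The image of a line under the parametrization of a subspace. -/
def subspaceLine (V : Subspace κ α ι) (l : Line α κ) : Line α ι where
  idxFun i := (V.idxFun i).elim some l.idxFun
  proper := by
    obtain ⟨k, hk⟩ := l.proper
    obtain ⟨i, hi⟩ := V.proper k
    exact ⟨i, by simp [hi, hk]⟩

lemma subspaceLine_apply (V : Subspace κ α ι) (l : Line α κ) (a : α) :
    subspaceLine V l a = V (l a) := by
  ext i
  cases h : V.idxFun i <;> simp [Subspace.apply_def, subspaceLine, h]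

/-- A point and a subspace determine a subspace of the product. -/
def subspaceVertical (v : κ → α) (V : Subspace η α ι) : Subspace η α (κ ⊕ ι) where
  idxFun := Sum.elim (Sum.inl ∘ v) V.idxFun
  proper e := by
    obtain ⟨i, hi⟩ := V.proper e
    exact ⟨.inr i, by simp [hi]⟩

lemma subspaceVertical_apply (v : κ → α) (V : Subspace η α ι) (x : η → α) :
    subspaceVertical v V x = Sum.elim v (V x) := by
  ext i
  cases i <;> simp [Subspace.apply_def, subspaceVertical]

/-- A subspace and a point determine a subspace of the product. -/
def subspaceHorizontal (V : Subspace η α κ) (v : ι → α) : Subspace η α (κ ⊕ ι) where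
  idxFun := Sum.elim V.idxFun (Sum.inl ∘ v)
  proper e := by
    obtain ⟨i, hi⟩ := V.proper e
    exact ⟨.inl i, by simp [hi]⟩

lemma subspaceHorizontal_apply (V : Subspace η α κ) (v : ι → α) (x : η → α) :
    subspaceHorizontal V v x = Sum.elim (V x) v := by
  ext i
  cases i <;> simp [Subspace.apply_def, subspaceHorizontal]

/-- A line and a subspace determine a subspace of the product of one dimension more. -/
def lineProdSubspace (l : Line α κ) (V : Subspace η α ι) : Subspace (Option η) α (κ ⊕ ι) where
  idxFun := Sum.elim (fun i ↦ (l.idxFun i).elim (.inr none) .inl)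
    (fun i ↦ (V.idxFun i).map id some)
  proper e := by
    cases e with
    | none =>
      obtain ⟨i, hi⟩ := l.proper
      exact ⟨.inl i, by simp [hi]⟩
    | some e =>
      obtain ⟨i, hi⟩ := V.proper e
      exact ⟨.inr i, by simp [hi]⟩

lemma lineProdSubspace_apply (l : Line α κ) (V : Subspace η α ι) (x : Option η → α) :
    lineProdSubspace l V x = Sum.elim (l (x none)) (V (x ∘ some)) := by
  ext i
  rcases i with i | i
  · cases h : l.idxFun i <;> simp [Subspace.apply_def, lineProdSubspace, h]
  · cases h : V.idxFun i <;> simp [Subspace.apply_def, lineProdSubspace, h]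

end Subspace

/-! ### Density statements -/

section Density

variable (α : Type) [Fintype α]

/-- Every subset of `ι → α` of density at least `δ` contains a combinatorial line. -/
def HasLine (ι : Type) [Fintype ι] [DecidableEq ι] (δ : ℝ) : Prop :=
  ∀ A : (ι → α) → Prop, δ * Fintype.card (ι → α) ≤ count A → ∃ l : Line α ι, ∀ a, A (l a)

/-- Every subset of `ι → α` of density at least `δ` contains an `η`-dimensional subspace. -/
def HasSubspace (η ι : Type) [Fintype ι] [DecidableEq ι] (δ : ℝ) : Prop :=
  ∀ A : (ι → α) → Prop, δ * Fintype.card (ι → α) ≤ count A →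
    ∃ V : Subspace η α ι, ∀ x, A (V x)

/-- The density Hales-Jewett property for the alphabet `α` at density `δ`. -/
def DHJ (δ : ℝ) : Prop :=
  ∃ (ι : Type) (_ : Fintype ι) (_ : DecidableEq ι), HasLine α ι δ

variable {α}

lemma DHJ.mono {δ δ' : ℝ} (h : DHJ α δ) (hδ : δ ≤ δ') : DHJ α δ' := by
  obtain ⟨ι, hF, hD, hι⟩ := h
  exact ⟨ι, hF, hD, fun A hA ↦ hι A ((mul_le_mul_of_nonneg_right hδ (by positivity)).trans hA)⟩

lemma dhj_of_one_lt [Nonempty α] {δ : ℝ} (hδ : 1 < δ) : DHJ α δ := by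
  refine ⟨Unit, inferInstance, inferInstance, fun A hA ↦ ?_⟩
  have h := count_le_card A
  have : (0 : ℝ) < Fintype.card (Unit → α) := by exact_mod_cast Fintype.card_pos
  nlinarith

/-- The multidimensional density Hales-Jewett theorem follows from the one-dimensional one. -/
lemma exists_hasSubspace [Nonempty α] (hα : ∀ δ > 0, DHJ α δ) (η : Type) [Finite η] :
    ∀ δ > 0, ∃ (ι : Type) (_ : Fintype ι) (_ : DecidableEq ι), HasSubspace α η ι δ := by
  induction η using Finite.induction_empty_option with
  | of_equiv e ih =>
    intro δ hδ
    obtain ⟨ι, _, _, hι⟩ := ih δ hδ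
    refine ⟨ι, ‹_›, ‹_›, fun A hA ↦ ?_⟩
    obtain ⟨V, hV⟩ := hι A hA
    refine ⟨V.reindex e (.refl α) (.refl ι), fun x ↦ ?_⟩
    convert hV (x ∘ e) using 1
    ext i
    simp
  | h_empty =>
    intro δ hδ
    refine ⟨Unit, inferInstance, inferInstance, fun A hA ↦ ?_⟩
    have : (0 : ℝ) < Fintype.card (Unit → α) := by exact_mod_cast Fintype.card_pos
    obtain ⟨w, hw⟩ := exists_of_count_pos (lt_of_lt_of_le (by positivity) hA)
    exact ⟨⟨Sum.inl ∘ w, fun e ↦ e.elim⟩, fun x ↦ hw⟩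
  | h_option ih =>
    intro δ hδ
    obtain ⟨κ, _, _, hκ⟩ := hα (δ / 2) (by positivity)
    obtain ⟨ι, _, _, hι⟩ := ih (δ / (2 * (Fintype.card (Line α κ) + 1))) (by positivity)
    refine ⟨κ ⊕ ι, inferInstance, inferInstance, fun A hA ↦ ?_⟩
    obtain ⟨l, hl⟩ := exists_dense_fibers (X := κ → α) (Y := ι → α) hδ
      (fun (l : Line α κ) x ↦ ∃ a, l a = x)
      (fun x y ↦ A (Sum.elim x y))
      (fun y hy ↦ by
        obtain ⟨l, hl⟩ := hκ _ hy
        exact ⟨l, by rintro _ ⟨a, rfl⟩; exact hl a⟩)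
      (by rwa [mul_assoc, ← card_arrow_sum, ← count_arrow_sum'])
    obtain ⟨V, hV⟩ := hι _ hl
    refine ⟨lineProdSubspace l V, fun x ↦ ?_⟩
    rw [lineProdSubspace_apply]
    exact hV _ _ ⟨_, rfl⟩

end Density

/-! ### Insensitive sets -/

section Insensitive

variable {α : Type}

/-- A set of words over `Option α` is insensitive at `a` if membership does not change when some
letters `a` are replaced by `none` or vice versa. -/
def Insensitive {ι : Type} (a : α) (D : (ι → Option α) → Prop) : Prop :=
  ∀ w w' : ι → Option α, (∀ i, (w i).getD a = (w' i).getD a) → D w → D w'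

lemma Insensitive.comp_subspace {ι η : Type} {a : α} {D : (ι → Option α) → Prop}
    (hD : Insensitive a D) (V : Subspace η (Option α) ι) : Insensitive a fun x ↦ D (V x) := by
  intro w w' hw
  refine hD _ _ fun i ↦ ?_
  cases h : V.idxFun i <;> simp [Subspace.apply_def, h, hw]

variable [Fintype α]

lemma count_block_none {κ : Type} [Fintype κ] [DecidableEq κ] (B : ℕ) (k : κ) :
    (count fun w : κ × Fin B → Option α ↦ ∀ b, w (k, b) = none) *
      (Fintype.card (Option α) : ℝ) ^ B = Fintype.card (κ × Fin B → Option α) := by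
  classical
  have h : (count fun w : κ × Fin B → Option α ↦ ∀ b, w (k, b) = none) =
      ((Fintype.piFinset fun p : κ × Fin B ↦
        if p.1 = k then ({none} : Finset (Option α)) else univ).card : ℝ) := by
    rw [count_eq_card]
    congr 2
    ext w
    simp only [mem_filter, mem_univ, true_and, Fintype.mem_piFinset]
    refine ⟨fun h ⟨k', b⟩ ↦ ?_, fun h b ↦ by simpa using h (k, b)⟩
    split_ifs with hk
    · obtain rfl : k' = k := hk
      simpa using h b
    · exact mem_univ _
  have h2 : (Fintype.card (Option α)) ^ B =
      ∏ p : κ × Fin B, if p.1 = k then Fintype.card (Option α) else 1 := by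
    rw [Fintype.prod_prod_type]
    simp [prod_ite_eq']
  rw [h, Fintype.card_piFinset]
  norm_cast
  rw [h2, ← prod_mul_distrib, Fintype.card_pi]
  refine prod_congr rfl fun p _ ↦ ?_
  split_ifs <;> simp

/-- If the multidimensional density Hales-Jewett theorem holds for `α`, then dense insensitive sets
of words over `Option α` contain subspaces over `Option α`. -/
lemma exists_insensitive_subspace (hα : ∀ δ > 0, DHJ α δ) (a : α) (η : Type) [Finite η]
    {β : ℝ} (hβ : 0 < β) :
    ∃ (κ : Type) (_ : Fintype κ) (_ : DecidableEq κ), ∀ D : (κ → Option α) → Prop,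
      Insensitive a D → β * Fintype.card (κ → Option α) ≤ count D →
        ∃ V : Subspace η (Option α) κ, ∀ x, D (V x) := by
  have : Nonempty α := ⟨a⟩
  obtain ⟨κ, _, _, hκ⟩ := exists_hasSubspace hα η (β / 4) (by positivity)
  have hcard : (2 : ℝ) ≤ Fintype.card (Option α) := by
    have : 0 < Fintype.card α := Fintype.card_pos
    rw [Fintype.card_option]
    exact_mod_cast (by omega : 2 ≤ Fintype.card α + 1)
  obtain ⟨B, hB⟩ := pow_unbounded_of_one_lt (Fintype.card κ / (β / 2))
    (show (1 : ℝ) < Fintype.card (Option α) by linarith)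
  have hB' : (Fintype.card κ : ℝ) ≤ β / 2 * (Fintype.card (Option α) : ℝ) ^ (B + 1) := by
    rw [div_lt_iff₀ (by positivity)] at hB
    have : (Fintype.card (Option α) : ℝ) ^ B ≤ (Fintype.card (Option α) : ℝ) ^ (B + 1) :=
      pow_le_pow_right₀ (by linarith) (by omega)
    nlinarith
  refine ⟨κ × Fin (B + 1), inferInstance, inferInstance, fun D hD hcount ↦ ?_⟩
  have hpos : ∀ s : κ → Fin (B + 1) → Bool, ∃ p : κ → Fin (B + 1),
      ∀ k, (∃ b, s k b) → s k (p k) := by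
    intro s
    have : ∀ k, ∃ b, (∃ b, s k b) → s k b := fun k ↦ by
      by_cases h : ∃ b, s k b
      · exact ⟨h.choose, fun _ ↦ h.choose_spec⟩
      · exact ⟨0, fun h' ↦ (h h').elim⟩
    choose p hp using this
    exact ⟨p, hp⟩
  choose pos hpos using hpos
  let supp (w : κ × Fin (B + 1) → Option α) : κ → Fin (B + 1) → Bool := fun k b ↦ (w (k, b)).isSome
  let good (w : κ × Fin (B + 1) → Option α) : Prop := ∀ k, ∃ b, supp w k b
  let subst (w : κ × Fin (B + 1) → Option α) (u : κ → α) : κ × Fin (B + 1) → Option α :=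
    fun p ↦ if p.2 = pos (supp w) p.1 then some (u p.1) else w p
  let old (w : κ × Fin (B + 1) → Option α) : κ → α := fun k ↦ (w (k, pos (supp w) k)).getD a
  have hsupp : ∀ w u, good w → supp (subst w u) = supp w := by
    intro w u hw
    ext k b
    by_cases hb : b = pos (supp w) k
    · have h1 : supp w k b := by rw [hb]; exact hpos _ k (hw k)
      have h2 : supp (subst w u) k b := by simp [supp, subst, hb]
      rw [h1, h2]
    · simp [supp, subst, hb]
  have hsubst : ∀ w u, good w → subst (subst w u) (old w) = w := by
    intro w u hw
    ext1 ⟨k, b⟩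
    by_cases hb : b = pos (supp w) k
    · have h1 : supp w k (pos (supp w) k) := hpos _ k (hw k)
      obtain ⟨c, hc⟩ := Option.isSome_iff_exists.1 h1
      simp only [subst, hsupp w u hw, hb, if_true, old, hc, Option.getD_some]
    · simp [subst, hsupp w u hw, hb]
  have hold : ∀ w u, good w → old (subst w u) = u := by
    intro w u hw
    ext k
    simp [old, hsupp w u hw, subst]
  have hgood : ∀ w u, good w → good (subst w u) := by
    intro w u hw
    simpa only [good, hsupp w u hw] using hw
  have hsum : (count fun w ↦ good w ∧ D w) * Fintype.card (κ → α) =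
      ∑ w, count fun u : κ → α ↦ good w ∧ D (subst w u) := by
    classical
    rw [mul_comm, card_mul_count, sum_count, count_eq_card, count_eq_card]
    congr 1
    refine card_nbij' (fun p ↦ (subst p.1 p.2, old p.1)) (fun p ↦ (subst p.1 p.2, old p.1))
      ?_ ?_ ?_ ?_
    · rintro ⟨w, u⟩ hp
      simp only [coe_filter, mem_univ, true_and, Set.mem_ofPred_eq] at hp ⊢
      exact ⟨hgood w u hp.1, by rw [hsubst w u hp.1]; exact hp.2⟩
    · rintro ⟨w, u⟩ hp
      simp only [coe_filter, mem_univ, true_and, Set.mem_ofPred_eq] at hp ⊢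
      exact ⟨hgood w u hp.1, hp.2⟩
    · rintro ⟨w, u⟩ hp
      simp only [coe_filter, mem_univ, true_and, Set.mem_ofPred_eq] at hp
      simp [hsubst w u hp.1, hold w u hp.1]
    · rintro ⟨w, u⟩ hp
      simp only [coe_filter, mem_univ, true_and, Set.mem_ofPred_eq] at hp
      simp [hsubst w u hp.1, hold w u hp.1]
  have hN : (0 : ℝ) < Fintype.card (κ × Fin (B + 1) → Option α) := by
    exact_mod_cast Fintype.card_pos
  have hU : (0 : ℝ) < Fintype.card (κ → α) := by exact_mod_cast Fintype.card_pos
  have hbad : (count fun w ↦ ¬ good w) ≤ β / 2 * Fintype.card (κ × Fin (B + 1) → Option α) := by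
    have h1 : (count fun w ↦ ¬ good w) ≤
        ∑ k, count fun w : κ × Fin (B + 1) → Option α ↦ ∀ b, w (k, b) = none := by
      refine le_trans (count_mono fun w hw ↦ ?_) (count_exists_le _)
      simpa [good, supp] using hw
    have h2 := sum_congr (rfl : (univ : Finset κ) = univ)
      fun k _ ↦ count_block_none (α := α) (B + 1) k
    rw [← sum_mul, sum_const, card_univ, nsmul_eq_mul] at h2
    have hK : (0 : ℝ) < (Fintype.card (Option α) : ℝ) ^ (B + 1) := by positivity
    refine h1.trans (le_of_mul_le_mul_right ?_ hK)
    rw [h2]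
    nlinarith
  have hDgood : β / 2 * Fintype.card (κ × Fin (B + 1) → Option α) ≤
      count fun w ↦ good w ∧ D w := by
    have : count D ≤ (count fun w ↦ ¬ good w) + count fun w ↦ good w ∧ D w := by
      unfold count
      rw [← sum_add_distrib]
      refine sum_le_sum fun w _ ↦ ?_
      by_cases h1 : good w <;> by_cases h2 : D w <;> simp [h1, h2]
    linarith
  obtain ⟨w, hw, hwD⟩ : ∃ w, good w ∧
      β / 4 * Fintype.card (κ → α) ≤ count fun u ↦ D (subst w u) := by
    by_contra! hlt
    have : ∑ w, (count fun u : κ → α ↦ good w ∧ D (subst w u)) ≤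
        ∑ _w : κ × Fin (B + 1) → Option α, β / 4 * (Fintype.card (κ → α) : ℝ) := by
      refine sum_le_sum fun w _ ↦ ?_
      by_cases hw : good w
      · simpa only [hw, true_and] using (hlt w hw).le
      · simp only [hw, false_and, count, if_false, sum_const_zero]
        positivity
    rw [← hsum, sum_const, card_univ, nsmul_eq_mul] at this
    have h2 := mul_le_mul_of_nonneg_right hDgood hU.le
    have h3 := mul_pos (mul_pos hN hU) hβ
    nlinarith
  obtain ⟨V, hV⟩ := hκ _ hwD
  refine ⟨⟨fun p ↦ if p.2 = pos (supp w) p.1 then (V.idxFun p.1).map some id else .inl (w p),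
    fun e ↦ ?_⟩, fun x ↦ ?_⟩
  · obtain ⟨k, hk⟩ := V.proper e
    exact ⟨(k, pos (supp w) k), by simp [hk]⟩
  · refine hD _ _ (fun p ↦ ?_) (hV fun e ↦ (x e).getD a)
    by_cases hp : p.2 = pos (supp w) p.1
    · cases h : V.idxFun p.1 <;> simp [Subspace.apply_def, subst, hp, h]
    · simp [Subspace.apply_def, subst, hp]

open scoped Classical in
/-- For insensitive sets `D`, the sum over `D` of a function bounded by one with nonpositive sums
over `η`-dimensional subspaces is at most `b` times the size of the cube plus `c` times the size
of `D`. -/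
def InsensitiveSumLE (a : α) (η ι : Type) [Fintype η] [DecidableEq η] [Fintype ι] [DecidableEq ι]
    (b c : ℝ) : Prop :=
  ∀ D : (ι → Option α) → Prop, Insensitive a D → ∀ F : (ι → Option α) → ℝ, (∀ w, F w ≤ 1) →
    (∀ V : Subspace η (Option α) ι, ∑ x, F (V x) ≤ 0) →
    ∑ w, (if D w then F w else 0) ≤ b * Fintype.card (ι → Option α) + c * count D

lemma sum_ite_le_count {X : Type*} [Fintype X] (D : X → Prop) [DecidablePred D] (F : X → ℝ)
    (hF : ∀ w, F w ≤ 1) : ∑ w, (if D w then F w else 0) ≤ count D := by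
  rw [count]
  refine sum_le_sum fun w _ ↦ ?_
  by_cases h : D w <;> simp [h, hF w]

lemma InsensitiveSumLE.sum_step {a : α} {η κ ι : Type} [Fintype η] [DecidableEq η] [Fintype κ]
    [DecidableEq κ] [Fintype ι] [DecidableEq ι] {β r c : ℝ} (hβ : 0 < β) (hr : 0 ≤ r)
    (hκ : ∀ D : (κ → Option α) → Prop, Insensitive a D →
      β / 2 * Fintype.card (κ → Option α) ≤ count D → ∃ V : Subspace η (Option α) κ, ∀ x, D (V x))
    (hc : c = β / (2 * (Fintype.card (Subspace η (Option α) κ) + 1)) /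
      Fintype.card (κ → Option α))
    (hι : InsensitiveSumLE a η ι β r) :
    InsensitiveSumLE a η (κ ⊕ ι) β (r * (1 - min c 1)) := by
  classical
  have hK : (0 : ℝ) < Fintype.card (κ → Option α) := by exact_mod_cast Fintype.card_pos
  have hcpos : 0 < c := by rw [hc]; positivity
  intro D hD F hF hV
  have hle1 : 0 ≤ 1 - min c 1 := by linarith [min_le_right c 1]
  rcases le_total (count D) (β * Fintype.card (κ ⊕ ι → Option α)) with hsmall | hlarge
  · have h1 := sum_ite_le_count D F hF
    have h2 : 0 ≤ r * (1 - min c 1) * count D :=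
      mul_nonneg (mul_nonneg hr hle1) (count_nonneg _)
    calc _ ≤ count D := by convert h1
      _ ≤ _ := by linarith
  obtain ⟨V, hE⟩ := exists_dense_fibers (X := κ → Option α) (Y := ι → Option α) hβ
    (fun (V : Subspace η (Option α) κ) x ↦ ∃ z, V z = x)
    (fun x y ↦ D (Sum.elim x y))
    (fun y hy ↦ by
      obtain ⟨V, hV⟩ := hκ _ (fun w w' hw hDw ↦ hD _ _ (fun i ↦ by
        cases i <;> simp [hw]) hDw) hy
      exact ⟨V, by rintro _ ⟨z, rfl⟩; exact hV z⟩)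
    (by rwa [mul_assoc, ← card_arrow_sum, ← count_arrow_sum'])
  set E : (ι → Option α) → Prop := fun y ↦ ∀ x, (∃ z, V z = x) → D (Sum.elim x y) with hEdef
  have hEins : Insensitive a E := fun y y' hy h x hx ↦
    hD _ _ (fun i ↦ by cases i <;> simp [hy]) (h x hx)
  set P : (κ → Option α) → (ι → Option α) → Prop := fun x y ↦ (∃ z, V z = x) ∧ E y with hP
  have hPD : ∀ x y, P x y → D (Sum.elim x y) := fun x y h ↦ h.2 x h.1
  have hsplit (G : (κ ⊕ ι → Option α) → ℝ) : ∑ w, (if D w then G w else 0) =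
      ∑ y, ∑ x, (if P x y then G (Sum.elim x y) else 0) +
      ∑ x, ∑ y, (if D (Sum.elim x y) ∧ ¬ P x y then G (Sum.elim x y) else 0) := by
    rw [sum_comm (s := (univ : Finset (ι → Option α))), sum_arrow_sum, ← sum_add_distrib]
    refine sum_congr rfl fun x _ ↦ ?_
    rw [← sum_add_distrib]
    exact sum_congr rfl fun y _ ↦ ite_eq_add_of_imp (hPD x y) _
  have hcD : count D = (∑ y, count fun x ↦ P x y) +
      ∑ x, count fun y ↦ D (Sum.elim x y) ∧ ¬ P x y := by
    have := hsplit fun _ ↦ 1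
    unfold count
    convert this
  have hP0 : ∑ y, ∑ x, (if P x y then F (Sum.elim x y) else 0) ≤ 0 := by
    refine sum_nonpos fun y _ ↦ ?_
    by_cases hy : E y
    · refine le_trans (le_of_eq ?_) (hV (subspaceHorizontal V y))
      simp only [hP, hy, and_true, subspaceHorizontal_apply]
      rw [← sum_filter, ← sum_image (g := fun z ↦ V z) (s := univ)
        (f := fun x ↦ F (Sum.elim x y)) (subspace_injective V).injOn]
      refine sum_congr ?_ fun _ _ ↦ rfl
      ext x
      simp
    · simp only [hP, hy, and_false, if_false, sum_const_zero, le_refl]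
  have hPcount : c * Fintype.card (κ ⊕ ι → Option α) ≤ ∑ y, count fun x ↦ P x y := by
    have h1 : c * Fintype.card (κ ⊕ ι → Option α) ≤ count E := by
      rwa [card_arrow_sum, hc, ← mul_assoc, div_mul_cancel₀ _ hK.ne']
    refine h1.trans (sum_le_sum fun y _ ↦ ?_)
    split_ifs with hy
    · unfold count
      refine le_trans ?_ (single_le_sum (fun x _ ↦ ?_) (mem_univ (V fun _ ↦ none)))
      · rw [if_pos ⟨⟨_, rfl⟩, hy⟩]
      · split_ifs <;> simp
    · exact count_nonneg _
  have hrest : ∑ x, ∑ y, (if D (Sum.elim x y) ∧ ¬ P x y then F (Sum.elim x y) else 0) ≤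
      ∑ x : κ → Option α, (β * Fintype.card (ι → Option α) +
        r * count fun y ↦ D (Sum.elim x y) ∧ ¬ P x y) := by
    refine sum_le_sum fun x _ ↦ ?_
    have h := hι (fun y ↦ D (Sum.elim x y) ∧ ¬ P x y)
      (fun y y' hy ⟨h1, h2⟩ ↦ ⟨hD _ _ (fun i ↦ by cases i <;> simp [hy]) h1,
        fun h3 ↦ h2 ⟨h3.1, hEins y' y (fun i ↦ (hy i).symm) h3.2⟩⟩)
      (fun y ↦ F (Sum.elim x y)) (fun y ↦ hF _)
      (fun U ↦ by simpa only [subspaceVertical_apply] using hV (subspaceVertical x U))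
    exact le_trans (le_of_eq (by congr!)) h
  rw [sum_add_distrib, sum_const, card_univ, nsmul_eq_mul, ← mul_sum] at hrest
  have hminc : min c 1 * count D ≤ ∑ y, count fun x ↦ P x y := by
    refine le_trans ?_ hPcount
    exact mul_le_mul (min_le_left _ _) (count_le_card D) (count_nonneg _) hcpos.le
  have h1 : (∑ x, count fun y ↦ D (Sum.elim x y) ∧ ¬ P x y) ≤ (1 - min c 1) * count D := by
    linarith
  have h2 := mul_le_mul_of_nonneg_left h1 hr
  have h3 := hsplit F
  calc _ = _ := by convert h3
    _ ≤ _ := by rw [card_arrow_sum]; linarith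

/-- Sums over insensitive sets of a function with nonpositive sums over subspaces are small. -/
lemma exists_insensitiveSumLE (hα : ∀ δ > 0, DHJ α δ) (a : α) (η : Type) [Fintype η]
    [DecidableEq η] {β : ℝ} (hβ : 0 < β) :
    ∃ (ι : Type) (_ : Fintype ι) (_ : DecidableEq ι), InsensitiveSumLE a η ι β 0 := by
  obtain ⟨κ, _, _, hκ⟩ := exists_insensitive_subspace hα a η (half_pos (half_pos hβ))
  obtain ⟨c, hc⟩ : ∃ c : ℝ, c = β / 2 / (2 * (Fintype.card (Subspace η (Option α) κ) + 1)) /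
    Fintype.card (κ → Option α) := ⟨_, rfl⟩
  have hK : (0 : ℝ) < Fintype.card (κ → Option α) := by exact_mod_cast Fintype.card_pos
  have hcpos : 0 < c := by rw [hc]; positivity
  have key : ∀ t : ℕ, ∃ (ι : Type) (_ : Fintype ι) (_ : DecidableEq ι),
      InsensitiveSumLE a η ι (β / 2) ((1 - min c 1) ^ t) := by
    intro t
    induction t with
    | zero =>
      classical
      refine ⟨Unit, inferInstance, inferInstance, fun D hD F hF hV ↦ ?_⟩
      have h1 := sum_ite_le_count D F hF
      have h2 : 0 ≤ β / 2 * (Fintype.card (Unit → Option α) : ℝ) := by positivity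
      linarith
    | succ t ih =>
      obtain ⟨ι, _, _, hι⟩ := ih
      have hle1 : 0 ≤ 1 - min c 1 := by linarith [min_le_right c 1]
      exact ⟨κ ⊕ ι, inferInstance, inferInstance, hι.sum_step (half_pos hβ)
        (pow_nonneg hle1 t) hκ hc⟩
  obtain ⟨t, ht⟩ := exists_pow_lt_of_lt_one (half_pos hβ)
    (show 1 - min c 1 < 1 by have := lt_min hcpos one_pos; linarith)
  obtain ⟨ι, hF, hD, hι⟩ := key t
  refine ⟨ι, hF, hD, fun D hD F hF hV ↦ (hι D hD F hF hV).trans ?_⟩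
  have h1 := count_le_card D
  have h2 : (1 - min c 1) ^ t * count D ≤ β / 2 * Fintype.card (ι → Option α) :=
    mul_le_mul ht.le h1 (count_nonneg _) (half_pos hβ).le
  linarith

end Insensitive

/-! ### The density increment argument -/

section Increment

variable {α : Type} [Fintype α]

open scoped Classical in
/-- Intersections of insensitive sets inherit the bound of `exists_insensitiveSumLE`. -/
lemma exists_sum_inter_le (hα : ∀ δ > 0, DHJ α δ) (s : Finset α) :
    ∀ (η : Type) [Fintype η] [DecidableEq η] {β : ℝ}, 0 < β →
    ∃ (ι : Type) (_ : Fintype ι) (_ : DecidableEq ι), ∀ D : α → (ι → Option α) → Prop,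
      (∀ a, Insensitive a (D a)) → ∀ F : (ι → Option α) → ℝ, (∀ w, F w ≤ 1) →
      (∀ V : Subspace η (Option α) ι, ∑ x, F (V x) ≤ 0) →
      ∑ w, (if ∀ a ∈ s, D a w then F w else 0) ≤ β * Fintype.card (ι → Option α) := by
  induction s using Finset.induction_on with
  | empty =>
    intro η _ _ β hβ
    refine ⟨η, inferInstance, inferInstance, fun D hD F hF hV ↦ ?_⟩
    have h : ∑ x, F x ≤ 0 := hV ⟨Sum.inr, fun e ↦ ⟨e, rfl⟩⟩
    simp only [notMem_empty, false_imp_iff, implies_true, if_true]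
    exact h.trans (by positivity)
  | insert a s _ ih =>
    intro η _ _ β hβ
    obtain ⟨κ, _, _, hκ⟩ := ih η (half_pos hβ)
    obtain ⟨ι, hι1, hι2, hι⟩ := exists_insensitiveSumLE hα a κ (half_pos hβ)
    refine ⟨ι, hι1, hι2, fun D hD F hF hV ↦ ?_⟩
    have h := hι (D a) (hD a) (fun w ↦ (if ∀ b ∈ s, D b w then F w else 0) - β / 2)
      (fun w ↦ by
        have := hF w
        split_ifs <;> linarith)
      (fun V ↦ by
        have h := hκ (fun b x ↦ D b (V x)) (fun b ↦ (hD b).comp_subspace V) (fun x ↦ F (V x))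
          (fun x ↦ hF _)
          (fun U ↦ by simpa only [subspaceComp_apply] using hV (subspaceComp V U))
        rw [sum_sub_distrib, sum_const, card_univ, nsmul_eq_mul]
        linarith)
    have hle : ∑ w, (if ∀ b ∈ insert a s, D b w then F w else 0) ≤
        ∑ w, (if D a w then (if ∀ b ∈ s, D b w then F w else 0) - β / 2 else 0) +
          β / 2 * Fintype.card (ι → Option α) := by
      rw [← card_univ, mul_comm (β / 2), ← nsmul_eq_mul, ← sum_const, ← sum_add_distrib]
      refine sum_le_sum fun w _ ↦ ?_
      simp only [forall_mem_insert]
      by_cases h1 : D a w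
      · simp [h1]
      · simpa [h1] using (half_pos hβ).le
    linarith

open scoped Classical in
/-- A union of complements of insensitive sets satisfies the bound of
`exists_insensitiveSumLE`. -/
lemma exists_sum_compl_inter_le (hα : ∀ δ > 0, DHJ α δ) (η : Type) [Fintype η] [DecidableEq η]
    {β : ℝ} (hβ : 0 < β) :
    ∃ (ι : Type) (_ : Fintype ι) (_ : DecidableEq ι), ∀ C : α → (ι → Option α) → Prop,
      (∀ a, Insensitive a (C a)) → ∀ F : (ι → Option α) → ℝ, (∀ w, F w ≤ 1) →
      (∀ V : Subspace η (Option α) ι, ∑ x, F (V x) ≤ 0) →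
      ∑ w, (if ∀ a, C a w then 0 else F w) ≤ β * Fintype.card (ι → Option α) := by
  have hT : (0 : ℝ) < Fintype.card (Finset α) := by exact_mod_cast Fintype.card_pos
  obtain ⟨ι, hι1, hι2, hι⟩ := exists_sum_inter_le hα univ η (div_pos hβ hT)
  refine ⟨ι, hι1, hι2, fun C hC F hF hV ↦ ?_⟩
  have hsplit : ∀ w, (if ∀ a, C a w then 0 else F w) = ∑ T : Finset α,
      if T = univ then 0 else if ∀ a ∈ univ, (C a w ↔ a ∈ T) then F w else 0 := by
    intro w
    rw [sum_eq_single ({a | C a w} : Finset α)]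
    · simp [filter_eq_self]
    · intro T _ hT
      have : ¬ ∀ a ∈ univ, (C a w ↔ a ∈ T) := fun h ↦ hT (by ext a; simp [h a (mem_univ a)])
      rw [if_neg this, ite_self]
    · simp
  rw [sum_congr rfl fun w _ ↦ hsplit w, sum_comm]
  have hle : ∀ T : Finset α, ∑ w : ι → Option α,
      (if T = univ then 0 else if ∀ a ∈ univ, (C a w ↔ a ∈ T) then F w else 0) ≤
        β / Fintype.card (Finset α) * Fintype.card (ι → Option α) := by
    intro T
    by_cases hTu : T = univ
    · simp only [hTu, if_true, sum_const_zero]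
      positivity
    · simp only [hTu, if_false]
      convert hι (fun a w ↦ C a w ↔ a ∈ T)
        (fun a w w' hw h ↦ Iff.trans ⟨hC a _ _ fun i ↦ (hw i).symm, hC a _ _ hw⟩ h) F hF hV
  refine (sum_le_sum fun T _ ↦ hle T).trans (le_of_eq ?_)
  rw [sum_const, card_univ, nsmul_eq_mul]
  field_simp

lemma sum_count_comm {X Y : Type*} [Fintype X] [Fintype Y] (p : X → Y → Prop) :
    ∑ x, count (p x) = ∑ y, count fun x ↦ p x y := by
  unfold count
  exact sum_comm

/-- The set of densities at which the density Hales-Jewett property holds has no positive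
minimal or infimal element. -/
lemma exists_lt_dhj_option [Nonempty α] (hα : ∀ δ > 0, DHJ α δ) {δ : ℝ} (hδ : 0 < δ)
    (h : ∀ δ' > δ, DHJ (Option α) δ') : ∃ δ' < δ, DHJ (Option α) δ' := by
  classical
  obtain ⟨κ, _, _, hκ⟩ := hα (δ / 2 / 2) (by positivity)
  obtain ⟨θ, hθ⟩ : ∃ θ, θ = δ / 2 / (2 * ((Fintype.card (Line α κ) : ℝ) + 1)) := ⟨_, rfl⟩
  have hθpos : 0 < θ := by rw [hθ]; positivity
  have hδθ : 0 < δ * θ := mul_pos hδ hθpos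
  obtain ⟨ι₁, _, _, hι₁⟩ := h (δ + δ * θ / 4) (by linarith)
  obtain ⟨m, _, _, hm⟩ := exists_sum_compl_inter_le hα ι₁ (β := δ * θ / 4) (by positivity)
  obtain ⟨M, _, hM⟩ := Subspace.exists_mono_in_high_dimension (α ⊕ κ) (Line α κ) m
  obtain ⟨K, hK⟩ : ∃ K : ℝ, K = Fintype.card (κ ⊕ M → Option α) := ⟨_, rfl⟩
  have hKpos : 0 < K := by rw [hK]; exact_mod_cast Fintype.card_pos
  obtain ⟨η, hη⟩ : ∃ η, η = min (δ / 4) (δ * θ / 8) / K := ⟨_, rfl⟩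
  have hηpos : 0 < η := by rw [hη]; positivity
  have hKη : K * η = min (δ / 4) (δ * θ / 8) := by rw [hη]; field_simp
  have hKη1 : K * η ≤ δ / 4 := hKη.trans_le (min_le_left _ _)
  have hKη2 : K * η ≤ δ * θ / 8 := hKη.trans_le (min_le_right _ _)
  obtain ⟨ι₂, _, _, hι₂⟩ := h (δ + η) (by linarith)
  refine ⟨δ - η, by linarith, (κ ⊕ M) ⊕ ι₂, inferInstance, inferInstance, fun A hA ↦ ?_⟩
  by_contra hno
  obtain ⟨Y, hY⟩ : ∃ Y : ℝ, Y = Fintype.card (ι₂ → Option α) := ⟨_, rfl⟩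
  have hYpos : 0 < Y := by rw [hY]; exact_mod_cast Fintype.card_pos
  have hupper : ∀ x, (count fun y ↦ A (Sum.elim x y)) ≤ (δ + η) * Y := by
    intro x
    by_contra! hlt
    rw [hY] at hlt
    obtain ⟨l, hl⟩ := hι₂ _ hlt.le
    exact hno ⟨l.vertical x, fun a ↦ by rw [Line.vertical_apply]; exact hl a⟩
  have hlower : ∀ x, (δ - 2 * (K * η)) * Y ≤ count fun y ↦ A (Sum.elim x y) := by
    intro x
    rw [count_arrow_sum, card_arrow_sum, ← hK, ← hY, ← add_sum_erase _ _ (mem_univ x)] at hA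
    have h1 := sum_le_card_nsmul (univ.erase x) (fun x ↦ count fun y ↦ A (Sum.elim x y)) _
      fun x _ ↦ hupper x
    rw [nsmul_eq_mul, card_erase_of_mem (mem_univ x), card_univ,
      Nat.cast_sub Fintype.card_pos, ← hK, Nat.cast_one] at h1
    nlinarith [mul_pos hηpos hYpos]
  have hline : ∀ W : M → α ⊕ κ, ∃ l : Line α κ, θ * Y ≤ count fun y : ι₂ → Option α ↦
      ∀ u, (∃ a, l a = u) →
        A (Sum.elim (fun j ↦ some (Sum.elim u (fun i ↦ Sum.elim id u (W i)) j)) y) := by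
    intro W
    rw [hθ, hY]
    refine exists_dense_fibers (half_pos hδ) (fun (l : Line α κ) u ↦ ∃ a, l a = u) _
      (fun y hy ↦ ?_) ?_
    · obtain ⟨l, hl⟩ := hκ _ hy
      exact ⟨l, by rintro _ ⟨a, rfl⟩; exact hl a⟩
    · rw [← sum_count_comm, ← hY]
      have h1 := card_nsmul_le_sum (univ : Finset (κ → α)) (fun u ↦ count fun y ↦
        A (Sum.elim (fun j ↦ some (Sum.elim u (fun i ↦ Sum.elim id u (W i)) j)) y)) (δ / 2 * Y)
        fun u _ ↦ le_trans (by nlinarith) (hlower _)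
      rw [nsmul_eq_mul, card_univ] at h1
      linarith
  choose L hL using hline
  obtain ⟨V, l, hl⟩ := hM L
  obtain ⟨j₀, hj₀⟩ := l.proper
  let Φ : Subspace m (Option α) (κ ⊕ M) :=
    { idxFun := Sum.elim (fun j ↦ .inl (l.idxFun j))
        fun i ↦ (V.idxFun i).elim (fun s ↦ .inl (s.elim some l.idxFun)) .inr
      proper := fun e ↦ by
        obtain ⟨i, hi⟩ := V.proper e
        exact ⟨.inr i, by simp [hi]⟩ }
  have hgood : ∀ x : m → Option α, θ * Y ≤ count fun y : ι₂ → Option α ↦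
      ∀ a, A (Sum.elim (fun j ↦ some ((Φ x j).getD a)) y) := by
    intro x
    refine (hL (V fun e ↦ (x e).elim (.inr j₀) .inl)).trans (count_mono fun y hy a ↦ ?_)
    rw [hl] at hy
    convert hy _ ⟨a, rfl⟩ using 4 with j
    rcases j with j | i
    · simp [Φ, Subspace.apply_def]
    · rcases hi : V.idxFun i with (b | j) | e
      · simp [Φ, Subspace.apply_def, hi]
      · simp [Φ, Subspace.apply_def, hi]
      · cases hx : x e <;> simp [Φ, Subspace.apply_def, hi, hx, hj₀]
  have hdisj : ∀ x y, (∀ a, A (Sum.elim (fun j ↦ some ((Φ x j).getD a)) y)) →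
      ¬ A (Sum.elim (Φ x) y) := by
    intro x y hC hAx
    refine hno ⟨⟨Sum.elim (fun j ↦ (Φ x j).map some) fun i ↦ some (y i), .inl (.inl j₀), ?_⟩, ?_⟩
    · simp [Φ, Subspace.apply_def, hj₀]
    · rintro (_ | a)
      · convert hAx using 1
        ext1 (j | i)
        · cases hj : Φ x j <;> simp [hj]
        · simp
      · convert hC a using 1
        ext1 (j | i)
        · cases hj : Φ x j <;> simp [hj]
        · simp
  obtain ⟨N, hN⟩ : ∃ N : ℝ, N = Fintype.card (m → Option α) := ⟨_, rfl⟩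
  have hNpos : 0 < N := by rw [hN]; exact_mod_cast Fintype.card_pos
  have hfiber : ∀ y : ι₂ → Option α, (count fun x ↦ A (Sum.elim (Φ x) y)) +
      (δ + δ * θ / 4) * (count fun x ↦ ∀ a, A (Sum.elim (fun j ↦ some ((Φ x j).getD a)) y)) ≤
      (δ + δ * θ / 4) * N + δ * θ / 4 * N := by
    intro y
    have h1 := hm (fun a x ↦ A (Sum.elim (fun j ↦ some ((Φ x j).getD a)) y))
      (fun a w w' hw hA ↦ by
        have heq : (fun j ↦ some ((Φ w' j).getD a)) = fun j ↦ some ((Φ w j).getD a) := by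
          funext j
          rcases hj : Φ.idxFun j with b | e <;> simp [Subspace.apply_def, hj, hw]
        beta_reduce
        rwa [heq])
      (fun x ↦ (if A (Sum.elim (Φ x) y) then 1 else 0) - (δ + δ * θ / 4))
      (fun x ↦ by split_ifs <;> linarith)
      (fun U ↦ by
        rw [sum_sub_distrib, sum_const, card_univ, nsmul_eq_mul, sub_nonpos]
        by_contra! hlt
        obtain ⟨l', hl'⟩ := hι₁ (fun z ↦ A (Sum.elim (Φ (U z)) y)) (by
          rw [mul_comm]; exact hlt.le)
        refine hno ⟨(subspaceLine Φ (subspaceLine U l')).horizontal y, fun a ↦ ?_⟩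
        rw [Line.horizontal_apply, subspaceLine_apply, subspaceLine_apply]
        exact hl' a)
    have h2 : (count fun x ↦ A (Sum.elim (Φ x) y)) + (δ + δ * θ / 4) *
        (count fun x ↦ ∀ a, A (Sum.elim (fun j ↦ some ((Φ x j).getD a)) y)) =
        (δ + δ * θ / 4) * N + ∑ x, (if ∀ a, A (Sum.elim (fun j ↦ some ((Φ x j).getD a)) y) then 0
          else (if A (Sum.elim (Φ x) y) then 1 else 0) - (δ + δ * θ / 4)) := by
      rw [hN, ← card_univ, mul_comm _ (((univ : Finset (m → Option α)).card : ℕ) : ℝ),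
        ← nsmul_eq_mul, ← sum_const, count, count, mul_sum, ← sum_add_distrib, ← sum_add_distrib]
      refine sum_congr rfl fun x _ ↦ ?_
      have := hdisj x y
      by_cases hC : ∀ a, A (Sum.elim (fun j ↦ some ((Φ x j).getD a)) y)
      · rw [if_neg (this hC), if_pos hC, if_pos hC]
        ring
      · rw [if_neg hC, if_neg hC]
        ring
    rw [h2, hN]
    linarith
  have hsum := sum_le_sum fun y (_ : y ∈ univ) ↦ hfiber y
  rw [sum_add_distrib, ← mul_sum, ← sum_count_comm (fun x y ↦ A (Sum.elim (Φ x) y)),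
    ← sum_count_comm (fun x y ↦ ∀ a, A (Sum.elim (fun j ↦ some ((Φ x j).getD a)) y)),
    sum_const, card_univ, nsmul_eq_mul, ← hY] at hsum
  have h1 := card_nsmul_le_sum (univ : Finset (m → Option α)) _ _
    fun x _ ↦ hlower (Φ x)
  have h2 := card_nsmul_le_sum (univ : Finset (m → Option α)) _ _ fun x _ ↦ hgood x
  rw [nsmul_eq_mul, card_univ, ← hN] at h1 h2
  have h3 := mul_le_mul_of_nonneg_left h2 (by positivity : 0 ≤ δ + δ * θ / 4)
  have h4 : (N * Y) * (δ - 2 * (K * η) + (δ + δ * θ / 4) * θ) ≤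
      (N * Y) * (δ + δ * θ / 4 + δ * θ / 4) := by
    linarith
  have h5 := le_of_mul_le_mul_left h4 (mul_pos hNpos hYpos)
  nlinarith [mul_pos hδθ hθpos]

lemma dhj_option [Nonempty α] (hα : ∀ δ > 0, DHJ α δ) : ∀ δ > 0, DHJ (Option α) δ := by
  set S : Set ℝ := {δ | 0 < δ ∧ DHJ (Option α) δ}
  have hbdd : BddBelow S := ⟨0, fun δ hδ ↦ hδ.1.le⟩
  have hne : S.Nonempty := ⟨2, two_pos, dhj_of_one_lt one_lt_two⟩
  have hgt : ∀ δ > sInf S, DHJ (Option α) δ := fun δ hδ ↦ by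
    obtain ⟨δ', hδ', hlt⟩ := exists_lt_of_csInf_lt hne hδ
    exact hδ'.2.mono hlt.le
  rcases (le_csInf hne fun δ hδ ↦ hδ.1.le : 0 ≤ sInf S).eq_or_lt with h0 | hpos
  · rwa [← h0] at hgt
  · obtain ⟨δ', hlt, hδ'⟩ := exists_lt_dhj_option hα hpos hgt
    have hmem : max δ' (sInf S / 2) ∈ S :=
      ⟨lt_max_of_lt_right (half_pos hpos), hδ'.mono (le_max_left _ _)⟩
    exact absurd (csInf_le hbdd hmem) (not_le.2 (max_lt hlt (half_lt_self hpos)))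

end Increment

lemma HasLine.of_equiv {α β ι : Type} [Fintype α] [Fintype β] [Fintype ι] [DecidableEq ι]
    {δ : ℝ} (e : α ≃ β) (h : HasLine α ι δ) : HasLine β ι δ := by
  intro A hA
  obtain ⟨l, hl⟩ := h (fun w ↦ A (e ∘ w)) (by
    have h1 : (count fun w : ι → α ↦ A (e ∘ w)) = count A := by
      unfold count
      exact Fintype.sum_equiv (Equiv.arrowCongr (.refl ι) e) _ _ fun w ↦ rfl
    rwa [h1, Fintype.card_congr (Equiv.arrowCongr (.refl ι) e)])
  refine ⟨l.map e, fun b ↦ ?_⟩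
  have := hl (e.symm b)
  rwa [← Line.map_apply, e.apply_symm_apply] at this

/-- The **density Hales-Jewett theorem**. -/
theorem density_hales_jewett (α : Type) [Finite α] :
    ∀ [Fintype α] [Nonempty α], ∀ δ > 0, DHJ α δ := by
  induction α using Finite.induction_empty_option with
  | of_equiv e ih =>
    intro _ _ δ hδ
    have := Fintype.ofEquiv _ e.symm
    have := e.nonempty
    obtain ⟨ι, h1, h2, hι⟩ := ih δ hδ
    exact ⟨ι, h1, h2, hι.of_equiv e⟩
  | h_empty => exact fun {_ h} ↦ h.elim fun x ↦ x.elim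
  | @h_option α _ ih =>
    intro inst _ δ hδ
    obtain rfl := Subsingleton.elim inst instFintypeOption
    rcases isEmpty_or_nonempty α with hα | hα
    · refine ⟨Unit, inferInstance, inferInstance, fun A hA ↦ ?_⟩
      obtain ⟨x, hx⟩ := exists_of_count_pos (hA.trans_lt' (by
        have : (0 : ℝ) < Fintype.card (Unit → Option α) := by exact_mod_cast Fintype.card_pos
        positivity))
      exact ⟨Line.diagonal _ _, fun a ↦ by
        rwa [Subsingleton.elim (Line.diagonal (Option α) Unit a) x]⟩
    · exact dhj_option ih δ hδ

end DensityHalesJewett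

/-- Szemerédi's Theorem: every subset of `{1, …, n}` of density at least `ε` contains an
arithmetic progression of length `k`, provided `n` is sufficiently large. -/
theorem szemeredi_theorem (ε : ℝ) (hε : 0 < ε) (k : ℕ) (hk : 0 < k) :
    ∃ N : ℕ, ∀ n : ℕ, n > N → ∀ A : Finset ℤ, A ⊆ Finset.Icc (1 : ℤ) n →
      ε ≤ (A.card : ℝ) / (n : ℝ) →
      ∃ a d : ℤ, 1 ≤ d ∧ ∀ j : ℕ, j ≤ k - 1 → a + (j : ℤ) * d ∈ A := by
  classical
  have : Nonempty (Fin k) := ⟨⟨0, hk⟩⟩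
  obtain ⟨ι, _, _, hι⟩ := DensityHalesJewett.density_hales_jewett (Fin k) (ε / 2) (half_pos hε)
  refine ⟨k * Fintype.card ι, fun n hn A hA hεA ↦ ?_⟩
  have hn0 : (0 : ℝ) < n := by exact_mod_cast (Nat.zero_le _).trans_lt hn
  rw [le_div_iff₀ hn0] at hεA
  obtain ⟨C, hC⟩ : ∃ C : ℝ, C = Fintype.card (ι → Fin k) := ⟨_, rfl⟩
  have hCpos : 0 < C := by rw [hC]; exact_mod_cast Fintype.card_pos
  let φ : (ι → Fin k) → ℤ := fun x ↦ ∑ i, ((x i : ℕ) : ℤ)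
  have hφ0 : ∀ x, 0 ≤ φ x := fun x ↦ Finset.sum_nonneg fun i _ ↦ by positivity
  have hφ1 : ∀ x, φ x ≤ k * Fintype.card ι := fun x ↦ by
    have := Finset.sum_le_card_nsmul Finset.univ (fun i ↦ ((x i : ℕ) : ℤ)) k
      fun i _ ↦ by exact_mod_cast (x i).2.le
    rwa [Finset.card_univ, nsmul_eq_mul, mul_comm] at this
  let I : Finset ℤ := Finset.Icc (1 - k * Fintype.card ι) n
  have hI : (I.card : ℝ) ≤ 2 * n := by
    have : I.card ≤ 2 * n := by
      simp only [I, Int.card_Icc]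
      have : ((k * Fintype.card ι : ℕ) : ℤ) < n := by exact_mod_cast hn
      push_cast at this
      omega
    exact_mod_cast this
  have hlow : C * A.card ≤ ∑ s ∈ I, DensityHalesJewett.count fun x ↦ s + φ x ∈ A := by
    unfold DensityHalesJewett.count
    rw [Finset.sum_comm, hC, ← Finset.card_univ, ← nsmul_eq_mul]
    refine Finset.card_nsmul_le_sum _ _ _ fun x _ ↦ ?_
    have hle : A.card ≤ Finset.card {s ∈ I | s + φ x ∈ A} := by
      refine Finset.card_le_card_of_injOn (fun b ↦ b - φ x) (fun b hb ↦ ?_)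
        fun b _ c _ h ↦ sub_left_injective h
      have h1 := Finset.mem_Icc.1 (hA hb)
      have h2 := hφ0 x
      have h3 := hφ1 x
      simp only [Finset.coe_filter, Set.mem_ofPred_eq, I, Finset.mem_Icc, sub_add_cancel]
      exact ⟨⟨by linarith, by linarith⟩, hb⟩
    rw [← Nat.cast_le (α := ℝ), ← Finset.sum_boole] at hle
    convert hle
  obtain ⟨s, hs⟩ : ∃ s, ε / 2 * C ≤ DensityHalesJewett.count fun x ↦ s + φ x ∈ A := by
    by_contra! hlt
    have hne : I.Nonempty := Finset.nonempty_Icc.2 (by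
      have : (0 : ℤ) ≤ k * Fintype.card ι := by positivity
      have : (0 : ℤ) < n := by exact_mod_cast hn0
      linarith)
    have h1 := Finset.sum_lt_sum_of_nonempty hne fun s _ ↦ hlt s
    rw [Finset.sum_const, nsmul_eq_mul] at h1
    nlinarith [mul_le_mul_of_nonneg_right hI (by positivity : 0 ≤ ε / 2 * C),
      mul_le_mul_of_nonneg_left hεA hCpos.le]
  rw [hC] at hs
  obtain ⟨l, hl⟩ := hι _ hs
  refine ⟨s + φ (l ⟨0, hk⟩), Finset.card {i | l.idxFun i = none}, ?_, fun j hj ↦ ?_⟩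
  · obtain ⟨i, hi⟩ := l.proper
    exact_mod_cast Finset.card_pos.2 ⟨i, by simpa using hi⟩
  · convert hl ⟨j, by omega⟩ using 1
    rw [add_assoc, add_right_inj, Finset.card_filter, Nat.cast_sum, Finset.mul_sum,
      ← Finset.sum_add_distrib]
    refine Finset.sum_congr rfl fun i _ ↦ ?_
    cases hi : l.idxFun i <;> simp [hi]
end

section
/- Let (X, 𝒜, μ) be a probability space, let k ≥ 1 be an integer, and let f : X^k → ℝ be bounded and measurable (with respect to the product σ-algebra). Then |∫_{X^k} f dμ^{⊗k}|^{2^k} ≤ G_k(f). -/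
open MeasureTheory

/-- The Gowers box expression
`G_k(f) = ∫ ∏_{ω ∈ {0,1}^k} f(h^{ω(1)}_1, …, h^{ω(k)}_k) d(μ^⊗k ⊗ μ^⊗k)(h⁰, h¹)`,
the `2^k`-th power of the `k`-th Gowers uniformity seminorm of `f`. -/
noncomputable def gowersBox {X : Type*} [MeasurableSpace X] (μ : Measure X) (k : ℕ)
    (f : (Fin k → X) → ℝ) : ℝ :=
  ∫ h : (Fin k → X) × (Fin k → X),
    ∏ ω : Fin k → Bool, f (fun i => if ω i then h.2 i else h.1 i)
    ∂((Measure.pi fun _ => μ).prod (Measure.pi fun _ => μ))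

/-- Swapping the two middle factors of a product of four measures is measure preserving. -/
theorem measurePreserving_prodProdProdComm {A B C D : Type*} [MeasurableSpace A]
    [MeasurableSpace B] [MeasurableSpace C] [MeasurableSpace D] (α : Measure A) (β : Measure B)
    (γ : Measure C) (δ : Measure D) [SFinite α] [SFinite β] [SFinite γ] [SFinite δ] :
    MeasurePreserving (Equiv.prodProdProdComm A B C D)
      ((α.prod β).prod (γ.prod δ)) ((α.prod γ).prod (β.prod δ)) :=
  have h₂ : MeasurePreserving (fun p : B × C × D => (p.2.1, p.1, p.2.2))
      (β.prod (γ.prod δ)) (γ.prod (β.prod δ)) :=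
    (measurePreserving_prodAssoc γ β δ).comp <|
      (Measure.measurePreserving_swap.prod (MeasurePreserving.id δ)).comp <|
        (measurePreserving_prodAssoc β γ δ).symm
  ((measurePreserving_prodAssoc α γ (β.prod δ)).symm).comp <|
    ((MeasurePreserving.id α).prod h₂).comp (measurePreserving_prodAssoc α β (γ.prod δ))

theorem measurePreserving_finCons {X : Type*} [MeasurableSpace X] (μ : Measure X) [SigmaFinite μ]
    (k : ℕ) :
    MeasurePreserving (fun p : X × (Fin k → X) => (Fin.cons p.1 p.2 : Fin (k + 1) → X))
      (μ.prod (Measure.pi fun _ => μ)) (Measure.pi fun _ => μ) := by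
  have h := (measurePreserving_piFinSuccAbove (fun _ : Fin (k + 1) => μ) 0).symm
  convert h using 1
  ext p : 1
  exact (Fin.insertNth_zero' p.1 p.2).symm

theorem integrable_of_measurable_of_abs_le {Ω : Type*} [MeasurableSpace Ω] {P : Measure Ω}
    [IsFiniteMeasure P] {u : Ω → ℝ} (hu : Measurable u) {C : ℝ} (hC : ∀ x, |u x| ≤ C) :
    Integrable u P :=
  .of_bound hu.aestronglyMeasurable C (.of_forall hC)

theorem sq_integral_le_integral_sq {Ω : Type*} [MeasurableSpace Ω] (P : Measure Ω)
    [IsProbabilityMeasure P] {u : Ω → ℝ} (hu : Measurable u) (hbdd : ∃ C : ℝ, ∀ x, |u x| ≤ C) :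
    (∫ x, u x ∂P) ^ 2 ≤ ∫ x, u x ^ 2 ∂P := by
  obtain ⟨C, hC⟩ := hbdd
  refine (Even.convexOn_pow (n := 2) even_two).map_integral_le (continuous_pow 2).continuousOn
    isClosed_univ (by simp) (integrable_of_measurable_of_abs_le hu hC)
    (integrable_of_measurable_of_abs_le (C := C ^ 2) (by fun_prop) fun x => ?_)
  simpa [abs_pow] using pow_le_pow_left₀ (abs_nonneg _) (hC x) 2

theorem integral_pow_two_pow_le {Ω : Type*} [MeasurableSpace Ω] (P : Measure Ω)
    [IsProbabilityMeasure P] (k : ℕ) {u : Ω → ℝ} (hu : Measurable u)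
    (hbdd : ∃ C : ℝ, ∀ x, |u x| ≤ C) :
    (∫ x, u x ∂P) ^ 2 ^ k ≤ ∫ x, u x ^ 2 ^ k ∂P := by
  induction k generalizing u with
  | zero => simp
  | succ k ih =>
    have hbdd' : ∃ C : ℝ, ∀ x, |u x ^ 2| ≤ C := by
      obtain ⟨C, hC⟩ := hbdd
      exact ⟨C ^ 2, fun x => by
        simpa [abs_pow] using pow_le_pow_left₀ (abs_nonneg _) (hC x) 2⟩
    simp only [pow_succ' 2 k, pow_mul]
    exact (pow_le_pow_left₀ (sq_nonneg _) (sq_integral_le_integral_sq P hu hbdd) _).trans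
      (ih (hu.pow_const 2) hbdd')

/-- The Gowers box expression in dimension `k + 1` is the average of the `k`-dimensional ones
over the multiplicative derivatives in the first coordinate. -/
theorem gowersBox_succ {X : Type*} [MeasurableSpace X] (μ : Measure X) [IsProbabilityMeasure μ]
    (k : ℕ) {f : (Fin (k + 1) → X) → ℝ} (hf : Measurable f) (hbdd : ∃ C : ℝ, ∀ x, |f x| ≤ C) :
    Integrable (fun p : X × X =>
      gowersBox μ k fun y => f (Fin.cons p.1 y) * f (Fin.cons p.2 y)) (μ.prod μ) ∧
    gowersBox μ (k + 1) f =
      ∫ p : X × X, gowersBox μ k (fun y => f (Fin.cons p.1 y) * f (Fin.cons p.2 y))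
        ∂(μ.prod μ) := by
  obtain ⟨C, hC⟩ := hbdd
  have hΦ := ((measurePreserving_finCons μ k).prod (measurePreserving_finCons μ k)).comp
    (measurePreserving_prodProdProdComm μ μ (Measure.pi fun _ : Fin k => μ)
      (Measure.pi fun _ : Fin k => μ))
  have hmeas : Measurable fun h : (Fin (k + 1) → X) × (Fin (k + 1) → X) =>
      ∏ ω : Fin (k + 1) → Bool, f (fun i => if ω i then h.2 i else h.1 i) := by
    refine Finset.measurable_fun_prod _ fun ω _ => hf.comp (measurable_pi_iff.2 fun i => ?_)
    split_ifs <;> fun_prop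
  have hsplit (p : (X × X) × ((Fin k → X) × (Fin k → X))) :
      ∏ ω : Fin (k + 1) → Bool, f (fun i => if ω i then (Fin.cons p.1.2 p.2.2 : Fin (k + 1) → X) i
          else (Fin.cons p.1.1 p.2.1 : Fin (k + 1) → X) i) =
        ∏ ω : Fin k → Bool, (f (Fin.cons p.1.1 fun i => if ω i then p.2.2 i else p.2.1 i) *
          f (Fin.cons p.1.2 fun i => if ω i then p.2.2 i else p.2.1 i)) := by
    rw [← (Fin.consEquiv fun _ => Bool).prod_comp, Fintype.prod_prod_type_right]
    refine Finset.prod_congr rfl fun ω _ => ?_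
    rw [Fintype.prod_bool, mul_comm]
    congr 2 <;> ext i <;> refine Fin.cases ?_ (fun j => ?_) i <;> simp [Fin.consEquiv]
  have hint := integrable_of_measurable_of_abs_le (P := (μ.prod μ).prod
      ((Measure.pi fun _ : Fin k => μ).prod (Measure.pi fun _ : Fin k => μ)))
    (hmeas.comp hΦ.measurable) (C := ∏ _ω : Fin (k + 1) → Bool, C) fun x => by
      rw [Function.comp_apply, Finset.abs_prod]
      exact Finset.prod_le_prod (fun _ _ => abs_nonneg _) fun _ _ => hC _
  replace hint := hint.congr (.of_forall hsplit)
  refine ⟨hint.integral_prod_left, ?_⟩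
  unfold gowersBox
  rw [← integral_prod _ hint, ← hΦ.map_eq,
    integral_map hΦ.aemeasurable hmeas.aestronglyMeasurable]
  exact integral_congr_ae (.of_forall hsplit)

theorem measurable_mul_finCons {X : Type*} [MeasurableSpace X] {k : ℕ}
    {f : (Fin (k + 1) → X) → ℝ} (hf : Measurable f) :
    Measurable fun q : (X × X) × (Fin k → X) =>
      f (Fin.cons q.1.1 q.2) * f (Fin.cons q.1.2 q.2) := by
  refine (hf.comp ?_).mul (hf.comp ?_) <;>
    refine measurable_pi_iff.2 (Fin.cases ?_ fun j => ?_) <;>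
    simp only [Fin.cons_zero, Fin.cons_succ] <;> fun_prop

/-- Cauchy–Schwarz in one coordinate. -/
theorem sq_integral_le_integral_integral_mul {X : Type*} [MeasurableSpace X] (μ : Measure X)
    [IsProbabilityMeasure μ] (k : ℕ) {f : (Fin (k + 1) → X) → ℝ} (hf : Measurable f)
    (hbdd : ∃ C : ℝ, ∀ x, |f x| ≤ C) :
    (∫ h, f h ∂(Measure.pi fun _ => μ)) ^ 2 ≤
      ∫ p : X × X, ∫ y, f (Fin.cons p.1 y) * f (Fin.cons p.2 y) ∂(Measure.pi fun _ => μ)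
        ∂(μ.prod μ) := by
  obtain ⟨C, hC⟩ := hbdd
  have hcons := measurePreserving_finCons μ k
  have hF : Measurable fun p : X × (Fin k → X) => f (Fin.cons p.1 p.2) :=
    hf.comp hcons.measurable
  have hGint := integrable_of_measurable_of_abs_le
    (P := (μ.prod μ).prod (Measure.pi fun _ : Fin k => μ)) (measurable_mul_finCons hf)
    (C := C * C) fun q => by
      rw [abs_mul]
      exact mul_le_mul (hC _) (hC _) (abs_nonneg _) ((abs_nonneg _).trans (hC (Fin.cons q.1.1 q.2)))
  have hu : Measurable fun y : Fin k → X => ∫ x, f (Fin.cons x y) ∂μ :=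
    (hF.stronglyMeasurable.integral_prod_left' (μ := μ)).measurable
  have hubdd (y : Fin k → X) : |∫ x, f (Fin.cons x y) ∂μ| ≤ C := by
    simpa using norm_integral_le_of_norm_le_const (μ := μ)
      (f := fun x => f (Fin.cons x y)) (.of_forall fun x => hC (Fin.cons x y))
  calc (∫ h, f h ∂(Measure.pi fun _ => μ)) ^ 2
      = (∫ y, ∫ x, f (Fin.cons x y) ∂μ ∂(Measure.pi fun _ : Fin k => μ)) ^ 2 := by
        rw [← hcons.map_eq, integral_map hcons.aemeasurable hf.aestronglyMeasurable,
          integral_prod_symm _ (integrable_of_measurable_of_abs_le hF fun _ => hC _)]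
    _ ≤ ∫ y, (∫ x, f (Fin.cons x y) ∂μ) ^ 2 ∂(Measure.pi fun _ : Fin k => μ) :=
        sq_integral_le_integral_sq _ hu ⟨C, hubdd⟩
    _ = ∫ y, ∫ p : X × X, f (Fin.cons p.1 y) * f (Fin.cons p.2 y) ∂(μ.prod μ)
          ∂(Measure.pi fun _ : Fin k => μ) := by
        refine integral_congr_ae (.of_forall fun y => ?_)
        simp only [sq]
        exact (integral_prod_mul (fun x => f (Fin.cons x y)) fun x => f (Fin.cons x y)).symm
    _ = _ := (integral_integral_swap hGint).symm

/-- Form of the Gowers–Cauchy–Schwarz inequality without absolute value, valid also for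
`k = 0`. -/
theorem integral_pow_le_gowersBox {X : Type*} [MeasurableSpace X] (μ : Measure X)
    [IsProbabilityMeasure μ] (k : ℕ) {f : (Fin k → X) → ℝ} (hf : Measurable f)
    (hbdd : ∃ C : ℝ, ∀ x, |f x| ≤ C) :
    (∫ h, f h ∂(Measure.pi fun _ => μ)) ^ 2 ^ k ≤ gowersBox μ k f := by
  induction k with
  | zero =>
    refine le_of_eq ?_
    have h (x : Fin 0 → X) : f x = f default := congrArg f (Subsingleton.elim _ _)
    simp [gowersBox, h]
  | succ k ih =>
    obtain ⟨hint, hsucc⟩ := gowersBox_succ μ k hf hbdd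
    have hCS := sq_integral_le_integral_integral_mul μ k hf hbdd
    obtain ⟨C, hC⟩ := hbdd
    have hG := measurable_mul_finCons hf
    have hGbdd (p : X × X) (y : Fin k → X) :
        |f (Fin.cons p.1 y) * f (Fin.cons p.2 y)| ≤ C * C := by
      rw [abs_mul]
      exact mul_le_mul (hC _) (hC _) (abs_nonneg _) ((abs_nonneg _).trans (hC (Fin.cons p.1 y)))
    have hu : Measurable fun p : X × X =>
        ∫ y, f (Fin.cons p.1 y) * f (Fin.cons p.2 y) ∂(Measure.pi fun _ : Fin k => μ) :=
      hG.stronglyMeasurable.integral_prod_right'.measurable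
    have hubdd (p : X × X) :
        |∫ y, f (Fin.cons p.1 y) * f (Fin.cons p.2 y) ∂(Measure.pi fun _ : Fin k => μ)| ≤
          C * C := by
      simpa using norm_integral_le_of_norm_le_const (μ := Measure.pi fun _ : Fin k => μ)
        (f := fun y => f (Fin.cons p.1 y) * f (Fin.cons p.2 y)) (.of_forall (hGbdd p))
    rw [pow_succ' 2 k, pow_mul, hsucc]
    refine (pow_le_pow_left₀ (sq_nonneg _) hCS _).trans
      ((integral_pow_two_pow_le _ k hu ⟨_, hubdd⟩).trans (integral_mono ?_ hint fun p => ?_))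
    · refine integrable_of_measurable_of_abs_le (hu.pow_const _) (C := (C * C) ^ 2 ^ k) fun p => ?_
      rw [abs_pow]
      exact pow_le_pow_left₀ (abs_nonneg _) (hubdd p) _
    · exact ih (hG.comp measurable_prodMk_left) ⟨_, hGbdd p⟩

/-- Gowers–Cauchy–Schwarz: `|∫ f dμ^⊗k|^(2^k) ≤ G_k(f)`. -/
theorem abs_integral_pow_le_gowersBox {X : Type*} [MeasurableSpace X] (μ : Measure X)
    [IsProbabilityMeasure μ] (k : ℕ) (hk : 1 ≤ k) (f : (Fin k → X) → ℝ)
    (hf : Measurable f) (hbdd : ∃ C : ℝ, ∀ x, |f x| ≤ C) :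
    |∫ h, f h ∂(Measure.pi fun _ => μ)| ^ (2 ^ k) ≤ gowersBox μ k f := by
  rw [(even_two.pow_of_ne_zero (by lia)).pow_abs]
  exact integral_pow_le_gowersBox μ k hf hbdd
end

section
/- Let (X, 𝒜, μ) be a probability space, let k ≥ 1 be an integer, and let f : X^k → ℝ be bounded and measurable. For each (k−1)-element subset I of {1,…,k}, let B_I ⊆ X^k be a set belonging to 𝓑_{k,I} (i.e., B_I = π_I^{-1}(S_I) for some measurable S_I ⊆ X^I). Then 0 ≤ G_k(f·∏_I 1_{B_I}) ≤ G_k(f), where the product runs over all (k−1)-element subsets I of {1,…,k} and 1_{B_I} is the indicator function of B_I. -/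
open MeasureTheory

/-- Interchanging the two middle factors of a fourfold product is measure preserving. -/
theorem measurePreserving_prodProdProdComm_s6 {α β γ δ : Type*} [MeasurableSpace α]
    [MeasurableSpace β] [MeasurableSpace γ] [MeasurableSpace δ] (μ : Measure α) (ν : Measure β)
    (ρ : Measure γ) (σ : Measure δ) [SFinite μ] [SFinite ν] [SFinite ρ] [SFinite σ] :
    MeasurePreserving (fun p : (α × β) × γ × δ => ((p.1.1, p.2.1), (p.1.2, p.2.2)))
      ((μ.prod ν).prod (ρ.prod σ)) ((μ.prod ρ).prod (ν.prod σ)) := by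
  have h₁ := measurePreserving_prodAssoc μ ν (ρ.prod σ)
  have h₂ := (MeasurePreserving.id μ).prod
    ((measurePreserving_prodAssoc ν ρ σ).symm MeasurableEquiv.prodAssoc)
  have h₃ := (MeasurePreserving.id μ).prod
    ((Measure.measurePreserving_swap (μ := ν) (ν := ρ)).prod (MeasurePreserving.id σ))
  have h₄ := (MeasurePreserving.id μ).prod (measurePreserving_prodAssoc ρ ν σ)
  have h₅ := (measurePreserving_prodAssoc μ ρ (ν.prod σ)).symm MeasurableEquiv.prodAssoc
  exact h₅.comp (h₄.comp (h₃.comp (h₂.comp h₁)))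

/-- The product of `f` over the vertices of the face of the box in which the `i`-th coordinate is
fixed to `x`. -/
def faceProd {X : Type*} {n : ℕ} (i : Fin (n + 1)) (f : (Fin (n + 1) → X) → ℝ) (x : X)
    (y : (Fin n → X) × (Fin n → X)) : ℝ :=
  ∏ ω : Fin n → Bool, f (i.insertNth x fun j => if ω j then y.2 j else y.1 j)

section FaceProd

variable {X : Type*} {n : ℕ} (i : Fin (n + 1)) {f : (Fin (n + 1) → X) → ℝ}

/-- The product over all vertices of the box splits into the products over two opposite faces. -/
theorem prod_box_eq_faceProd_mul (h : (Fin (n + 1) → X) × (Fin (n + 1) → X)) :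
    ∏ ω : Fin (n + 1) → Bool, f (fun j => if ω j then h.2 j else h.1 j) =
      faceProd i f (h.1 i) (i.removeNth h.1, i.removeNth h.2) *
        faceProd i f (h.2 i) (i.removeNth h.1, i.removeNth h.2) := by
  have key (b : Bool) (ω : Fin n → Bool) :
      (fun j => if (i.insertNth b ω : Fin (n + 1) → Bool) j then h.2 j else h.1 j) =
        i.insertNth (if b then h.2 i else h.1 i)
          fun j => if ω j then i.removeNth h.2 j else i.removeNth h.1 j := by
    refine Fin.eq_insertNth_iff.2 ⟨by simp, ?_⟩
    ext j
    simp [Fin.removeNth]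
  rw [← (Fin.insertNthEquiv (fun _ => Bool) i).prod_comp, Fintype.prod_prod_type,
    Fintype.prod_bool, mul_comm]
  simp only [Fin.insertNthEquiv_apply, key, faceProd]
  simp

theorem abs_faceProd_le {C : ℝ} (hC : ∀ x, |f x| ≤ C) (x : X)
    (y : (Fin n → X) × (Fin n → X)) :
    |faceProd i f x y| ≤ C ^ Fintype.card (Fin n → Bool) := by
  rw [faceProd, Finset.abs_prod]
  exact (Finset.prod_le_prod (fun _ _ => abs_nonneg _) fun _ _ => hC _).trans_eq (by simp)

variable [MeasurableSpace X]

theorem measurable_faceProd (hf : Measurable f) :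
    Measurable fun p : X × (Fin n → X) × (Fin n → X) => faceProd i f p.1 p.2 := by
  refine Finset.measurable_prod _ fun ω _ => hf.comp (measurable_pi_iff.2 fun j => ?_)
  refine Fin.succAboveCases i ?_ (fun j => ?_) j
  · simpa using measurable_fst
  · simp only [Fin.insertNth_apply_succAbove]
    cases ω j <;> simp <;> fun_prop

variable (μ : Measure X) [IsProbabilityMeasure μ]

theorem integrable_integral_faceProd_sq (hf : Measurable f) (hbdd : ∃ C : ℝ, ∀ x, |f x| ≤ C) :
    Integrable (fun y => (∫ x, faceProd i f x y ∂μ) ^ 2)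
      ((Measure.pi fun _ => μ).prod (Measure.pi fun _ => μ)) := by
  obtain ⟨C, hC⟩ := hbdd
  have hm : StronglyMeasurable fun y => ∫ x, faceProd i f x y ∂μ :=
    (measurable_faceProd i hf).stronglyMeasurable.integral_prod_left'
  refine Integrable.of_bound (hm.pow 2).aestronglyMeasurable
    ((C ^ Fintype.card (Fin n → Bool)) ^ 2) (.of_forall fun y => ?_)
  rw [norm_pow]
  gcongr
  have hb : ∀ᵐ x ∂μ, ‖faceProd i f x y‖ ≤ C ^ Fintype.card (Fin n → Bool) :=
    .of_forall fun x => abs_faceProd_le i hC x y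
  simpa using norm_integral_le_of_norm_le_const hb

/-- The Gowers box expression as an integral of squares. -/
theorem gowersBox_eq_integral_sq (hf : Measurable f) (hbdd : ∃ C : ℝ, ∀ x, |f x| ≤ C) :
    gowersBox μ (n + 1) f = ∫ y, (∫ x, faceProd i f x y ∂μ) ^ 2
      ∂((Measure.pi fun _ => μ).prod (Measure.pi fun _ => μ)) := by
  obtain ⟨C, hC⟩ := hbdd
  have hsplit := measurePreserving_piFinSuccAbove (fun _ : Fin (n + 1) => μ) i
  have hmp := (measurePreserving_prodProdProdComm_s6 μ (Measure.pi fun _ : Fin n => μ) μ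
    (Measure.pi fun _ : Fin n => μ)).comp (hsplit.prod hsplit)
  let F : (X × X) × ((Fin n → X) × (Fin n → X)) → ℝ :=
    fun p => faceProd i f p.1.1 p.2 * faceProd i f p.1.2 p.2
  have hF : Measurable F :=
    ((measurable_faceProd i hf).comp (by fun_prop :
        Measurable fun p : (X × X) × ((Fin n → X) × (Fin n → X)) => (p.1.1, p.2))).mul
      ((measurable_faceProd i hf).comp (by fun_prop :
        Measurable fun p : (X × X) × ((Fin n → X) × (Fin n → X)) => (p.1.2, p.2)))
  have hFi : Integrable F ((μ.prod μ).prod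
      ((Measure.pi fun _ => μ).prod (Measure.pi fun _ => μ))) := by
    refine Integrable.of_bound hF.aestronglyMeasurable
      ((C ^ Fintype.card (Fin n → Bool)) ^ 2) (.of_forall fun p => ?_)
    rw [sq, norm_mul]
    have hb := abs_faceProd_le i hC
    exact mul_le_mul (hb _ _) (hb _ _) (norm_nonneg _) ((abs_nonneg _).trans (hb p.1.1 p.2))
  calc gowersBox μ (n + 1) f
      = ∫ p, F p ∂((μ.prod μ).prod ((Measure.pi fun _ => μ).prod (Measure.pi fun _ => μ))) := by
        rw [← hmp.map_eq, integral_map hmp.measurable.aemeasurable hF.aestronglyMeasurable]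
        exact integral_congr_ae (.of_forall fun h => prod_box_eq_faceProd_mul i h)
    _ = _ := by
        rw [integral_prod_symm _ hFi]
        refine integral_congr_ae (.of_forall fun y => ?_)
        simp only [F, sq]
        exact integral_prod_mul (fun x => faceProd i f x y) (fun x => faceProd i f x y)

theorem gowersBox_nonneg (hf : Measurable f) (hbdd : ∃ C : ℝ, ∀ x, |f x| ≤ C) :
    0 ≤ gowersBox μ (n + 1) f := by
  rw [gowersBox_eq_integral_sq 0 μ hf hbdd]
  exact integral_nonneg fun _ => sq_nonneg _

/-- Multiplying by a function bounded by one and independent of one coordinate decreases the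
Gowers box expression. -/
theorem gowersBox_mul_le (hf : Measurable f) (hbdd : ∃ C : ℝ, ∀ x, |f x| ≤ C)
    {g : (Fin (n + 1) → X) → ℝ} (hg : Measurable g) (hg1 : ∀ x, |g x| ≤ 1)
    (hgi : ∀ (x x' : X) (y : Fin n → X), g (i.insertNth x y) = g (i.insertNth x' y)) :
    gowersBox μ (n + 1) (fun h => f h * g h) ≤ gowersBox μ (n + 1) f := by
  have hfg : ∃ C : ℝ, ∀ x, |f x * g x| ≤ C := by
    obtain ⟨C, hC⟩ := hbdd
    refine ⟨C, fun x => ?_⟩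
    rw [abs_mul]
    exact (mul_le_of_le_one_right (abs_nonneg _) (hg1 x)).trans (hC x)
  have hm : Measurable fun h => f h * g h := hf.mul hg
  rw [gowersBox_eq_integral_sq i μ hm hfg, gowersBox_eq_integral_sq i μ hf hbdd]
  refine integral_mono (integrable_integral_faceProd_sq i μ hm hfg)
    (integrable_integral_faceProd_sq i μ hf hbdd) fun y => ?_
  obtain ⟨x₀⟩ : Nonempty X := nonempty_of_isProbabilityMeasure μ
  have hpull (x : X) : faceProd i (fun h => f h * g h) x y =
      faceProd i f x y * faceProd i g x₀ y := by
    simp only [faceProd, Finset.prod_mul_distrib, hgi x x₀]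
  simp only [hpull, integral_mul_const, mul_pow]
  refine mul_le_of_le_one_right (sq_nonneg _) ?_
  rw [sq_le_one_iff_abs_le_one]
  simpa using abs_faceProd_le i hg1 x₀ y

end FaceProd

/-- Multiplying `f` by indicators of sets pulled back along the coordinate projections
`π_I`, for `(k-1)`-element subsets `I` of the coordinates, decreases the Gowers box
expression while keeping it nonnegative. -/
theorem gowersBox_mul_indicator_le {X : Type*} [MeasurableSpace X] (μ : Measure X)
    [IsProbabilityMeasure μ] (k : ℕ) (hk : 1 ≤ k) (f : (Fin k → X) → ℝ)
    (hf : Measurable f) (hbdd : ∃ C : ℝ, ∀ x, |f x| ≤ C)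
    (B : Finset (Fin k) → Set (Fin k → X))
    (hB : ∀ I : Finset (Fin k), I.card = k - 1 →
      ∃ S : Set (↥I → X), MeasurableSet S ∧
        B I = (fun (h : Fin k → X) (i : ↥I) => h i.1) ⁻¹' S) :
    0 ≤ gowersBox μ k
        (fun h => f h * ∏ I ∈ Finset.univ.filter (fun I : Finset (Fin k) => I.card = k - 1),
          Set.indicator (B I) (fun _ => (1 : ℝ)) h) ∧
      gowersBox μ k
        (fun h => f h * ∏ I ∈ Finset.univ.filter (fun I : Finset (Fin k) => I.card = k - 1),
          Set.indicator (B I) (fun _ => (1 : ℝ)) h) ≤ gowersBox μ k f := by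
  obtain ⟨n, rfl⟩ : ∃ n, k = n + 1 := ⟨k - 1, by omega⟩
  simp only [Nat.add_sub_cancel] at hB ⊢
  have hmeas (I : Finset (Fin (n + 1))) (hI : I.card = n) :
      Measurable (Set.indicator (B I) fun _ => (1 : ℝ)) := by
    obtain ⟨S, hS, hBS⟩ := hB I hI
    refine measurable_const.indicator (hBS ▸ hS.preimage ?_)
    exact measurable_pi_iff.2 fun j => measurable_pi_apply _
  have habs (I : Finset (Fin (n + 1))) (x : Fin (n + 1) → X) :
      |Set.indicator (B I) (fun _ => (1 : ℝ)) x| ≤ 1 := by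
    by_cases hx : x ∈ B I <;> simp [hx]
  have hstep (T : Finset (Finset (Fin (n + 1)))) (hT : ∀ I ∈ T, I.card = n) :
      Measurable (fun h => f h * ∏ I ∈ T, Set.indicator (B I) (fun _ => (1 : ℝ)) h) ∧
      (∃ C : ℝ, ∀ h, |f h * ∏ I ∈ T, Set.indicator (B I) (fun _ => (1 : ℝ)) h| ≤ C) ∧
      gowersBox μ (n + 1) (fun h => f h * ∏ I ∈ T, Set.indicator (B I) (fun _ => (1 : ℝ)) h) ≤
        gowersBox μ (n + 1) f := by
    induction T using Finset.induction_on with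
    | empty => simpa using ⟨hf, hbdd⟩
    | insert I T hIT ih =>
      obtain ⟨hm, ⟨C, hC⟩, hle⟩ := ih fun J hJ => hT J (Finset.mem_insert_of_mem hJ)
      have hI : I.card = n := hT I (Finset.mem_insert_self I T)
      simp only [Finset.prod_insert hIT, mul_comm (Set.indicator (B I) _ _), ← mul_assoc]
      refine ⟨hm.mul (hmeas I hI), ⟨C, fun h => ?_⟩, ?_⟩
      · rw [abs_mul]
        exact (mul_le_of_le_one_right (abs_nonneg _) (habs I h)).trans (hC h)
      · obtain ⟨i, hi⟩ : ∃ i, i ∉ I := by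
          by_contra! hall
          have : I = Finset.univ := Finset.eq_univ_iff_forall.2 hall
          simp [this] at hI
        refine (gowersBox_mul_le i μ hm ⟨C, hC⟩ (hmeas I hI) (habs I) fun x x' y => ?_).trans hle
        obtain ⟨S, -, hBS⟩ := hB I hI
        have hrestr : (fun j : I => (i.insertNth x y : Fin (n + 1) → X) j.1) =
            fun j : I => (i.insertNth x' y : Fin (n + 1) → X) j.1 := by
          ext ⟨j, hj⟩
          obtain ⟨j', rfl⟩ := Fin.exists_succAbove_eq (ne_of_mem_of_not_mem hj hi)
          simp
        classical
        simp only [hBS, Set.indicator_apply, Set.mem_preimage, hrestr]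
  obtain ⟨hm, hb, hle⟩ := hstep (Finset.univ.filter fun I => I.card = n) (by simp)
  exact ⟨gowersBox_nonneg μ hm hb, hle⟩
end

section
/- Let L be a first-order language, let I be a nonempty set, let 𝒰 be a countably incomplete ultrafilter on I, let (M_i)_{i ∈ I} be a family of L-structures, and let M := ∏_𝒰 M_i be their ultraproduct. Then M is ℵ₁-saturated in the following sense: for every positive integer n and every countable family (X_m)_{m ∈ ℕ} of subsets of M^n, each of which is definable in M with parameters from M, if the family has the finite intersection property (every finite subfamily has nonempty intersection), then ⋂_{m ∈ ℕ} X_m ≠ ∅. -/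
open FirstOrder Filter

/-- An ultrafilter is countably incomplete if it contains a decreasing chain of sets with
empty intersection. -/
def Ultrafilter.CountablyIncomplete {I : Type*} (𝒰 : Ultrafilter I) : Prop :=
  ∃ D : ℕ → Set I, (∀ m, D m ∈ 𝒰) ∧ (∀ m, D (m + 1) ⊆ D m) ∧ (⋂ m, D m) = ∅

/-- A countable family of internal predicates over a countably incomplete ultrafilter whose finite
subfamilies are almost everywhere satisfiable has a simultaneous almost everywhere solution. -/
theorem Ultrafilter.CountablyIncomplete.exists_forall_eventually {I : Type*} {𝒰 : Ultrafilter I}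
    (h𝒰 : 𝒰.CountablyIncomplete) {Y : I → Type*} [∀ i, Nonempty (Y i)] (S : ℕ → ∀ i, Set (Y i))
    (hS : ∀ k, ∀ᶠ i in (𝒰 : Filter I), ∃ y, ∀ m < k, y ∈ S m i) :
    ∃ y : ∀ i, Y i, ∀ m, ∀ᶠ i in (𝒰 : Filter I), y i ∈ S m i := by
  classical
  obtain ⟨D, hD, hsucc, hempty⟩ := h𝒰
  have hanti : Antitone D := antitone_nat_of_succ_le hsucc
  have key : ∀ i, ∃ y : Y i, ∀ k, i ∈ D k → (∃ z, ∀ m < k, z ∈ S m i) → ∀ m < k, y ∈ S m i := by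
    intro i
    obtain ⟨K, hK⟩ : ∃ K, i ∉ D K := by
      by_contra! h
      exact (hempty ▸ Set.mem_iInter.2 h : i ∈ (∅ : Set I))
    obtain ⟨y, hy⟩ := Nat.findGreatest_spec (P := fun k => ∃ z, ∀ m < k, z ∈ S m i) (Nat.zero_le K)
      ⟨Classical.arbitrary (Y i), fun m hm => absurd hm (Nat.not_lt_zero m)⟩
    refine ⟨y, fun k hk hz m hm => hy m (hm.trans_le (Nat.le_findGreatest ?_ hz))⟩
    by_contra! hlt
    exact hK (hanti hlt.le hk)
  choose y hy using key
  refine ⟨y, fun m => ?_⟩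
  filter_upwards [hD (m + 1), hS (m + 1)] with i hi hz
  exact hy i (m + 1) hi hz m m.lt_succ_self

/-- A set definable with parameters in an ultraproduct is internal. -/
theorem Set.Definable.exists_internal {L : FirstOrder.Language} {I : Type*} {𝒰 : Ultrafilter I}
    {M : I → Type*} [∀ i, L.Structure (M i)] [∀ i, Nonempty (M i)] {α : Type*}
    {A : Set (Filter.Product (𝒰 : Filter I) M)} {X : Set (α → Filter.Product (𝒰 : Filter I) M)}
    (hX : A.Definable L X) :
    ∃ S : ∀ i, Set (α → M i), ∀ x : α → ∀ i, M i,
      (fun j => (x j : Filter.Product (𝒰 : Filter I) M)) ∈ X ↔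
        ∀ᶠ i in (𝒰 : Filter I), (fun j => x j i) ∈ S i := by
  obtain ⟨φ, rfl⟩ := Set.definable_iff_exists_formula_sum.1 hX
  let b : A → ∀ i, M i := fun a => Quotient.out a.1
  refine ⟨fun i => {v | φ.Realize (Sum.elim (fun a => b a i) v)}, fun x => ?_⟩
  have h := FirstOrder.Language.Ultraproduct.realize_formula_cast (u := 𝒰) φ (Sum.elim b x)
  have hl : (fun c => ((Sum.elim b x c : ∀ i, M i) : Filter.Product (𝒰 : Filter I) M)) =
      Sum.elim (fun a : A => (a : Filter.Product (𝒰 : Filter I) M))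
        (fun j => (x j : Filter.Product (𝒰 : Filter I) M)) := by
    funext c
    rcases c with a | j
    · exact Quotient.out_eq a.1
    · rfl
  have hr : ∀ i, (fun c => Sum.elim b x c i) = Sum.elim (fun a => b a i) (fun j => x j i) := by
    intro i
    funext c
    rcases c with a | j <;> rfl
  simp only [hl, hr] at h
  exact h

/-- An ultraproduct with respect to a countably incomplete ultrafilter is `ℵ₁`-saturated:
every countable family of definable (with parameters) subsets of a finite power of the
ultraproduct with the finite intersection property has nonempty intersection. -/
theorem ultraproduct_aleph1_saturated
    (L : FirstOrder.Language) (I : Type) [Nonempty I] (𝒰 : Ultrafilter I)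
    (h𝒰 : 𝒰.CountablyIncomplete)
    (M : I → Type) [∀ i, L.Structure (M i)] [∀ i, Nonempty (M i)]
    (n : ℕ) (hn : 0 < n)
    (X : ℕ → Set (Fin n → Filter.Product (𝒰 : Filter I) M))
    (hdef : ∀ m, Set.Definable (Set.univ : Set (Filter.Product (𝒰 : Filter I) M)) L (X m))
    (hfip : ∀ s : Finset ℕ, (⋂ m ∈ s, X m).Nonempty) :
    (⋂ m, X m).Nonempty := by
  choose S hS using fun m => (hdef m).exists_internal
  obtain ⟨y, hy⟩ := h𝒰.exists_forall_eventually S fun k => by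
    obtain ⟨x, hx⟩ := hfip (Finset.range k)
    obtain ⟨z, rfl⟩ : ∃ z : Fin n → ∀ i, M i,
        (fun j => (z j : Filter.Product (𝒰 : Filter I) M)) = x :=
      ⟨fun j => Quotient.out (x j), funext fun j => Quotient.out_eq (x j)⟩
    have h : ∀ᶠ i in (𝒰 : Filter I), ∀ m ∈ Finset.range k, (fun j => z j i) ∈ S m i :=
      (Filter.eventually_all_finset _).2 fun m hm => (hS m z).1 (Set.mem_iInter₂.1 hx m hm)
    filter_upwards [h] with i hi
    exact ⟨fun j => z j i, fun m hm => hi m (Finset.mem_range.2 hm)⟩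
  exact ⟨_, Set.mem_iInter.2 fun m => (hS m fun j i => y i j).2 (hy m)⟩
end
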